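/- (Canonical min-max duality.) If (w̄,σ̄) is a stationary point of Ξ with σ̄ ∈ S⁺ (i.e. G(σ̄) is positive definite), then w̄ is a global minimizer of Π_p on ℝⁿ, σ̄ is a global maximizer of Π_d on S⁺, and Π_p(w̄) = Π_d(σ̄); in particular, w̄ is a global minimizer of Π_p on ℝⁿ if and only if σ̄ is a global maximizer of Π_d on S⁺. -/

import Mathlib

open Matrix

/-- `G σ = A + Σ σ_i B_i`. -/
noncomputable def G {n p : ℕ} (A : Matrix (Fin n) (Fin n) ℝ)
    (B : Fin p → Matrix (Fin n) (Fin n) ℝ) (σ : Fin p → ℝ) : Matrix (Fin n) (Fin n) ℝ :=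
  A + ∑ i, σ i • B i

/-- The total complementary energy
`Ξ(w,σ) = (1/2) wᵀ G(σ) w − (1/2) σᵀ K σ − ℓᵀ σ − fᵀ w − c`. -/
noncomputable def Xi {n p : ℕ} (A : Matrix (Fin n) (Fin n) ℝ)
    (B : Fin p → Matrix (Fin n) (Fin n) ℝ) (K : Matrix (Fin p) (Fin p) ℝ)
    (f : Fin n → ℝ) (ℓ : Fin p → ℝ) (c : ℝ) (w : Fin n → ℝ) (σ : Fin p → ℝ) : ℝ :=
  (1/2) * (w ⬝ᵥ (G A B σ).mulVec w) - (1/2) * (σ ⬝ᵥ K.mulVec σ) - ℓ ⬝ᵥ σ - f ⬝ᵥ w - c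

/-- `h(w)_i = (1/2) wᵀ B_i w`. -/
noncomputable def hq {n p : ℕ} (B : Fin p → Matrix (Fin n) (Fin n) ℝ)
    (w : Fin n → ℝ) : Fin p → ℝ :=
  fun i => (1/2) * (w ⬝ᵥ (B i).mulVec w)

/-- The total potential `Π_p(w) = sup_{σ} Ξ(w,σ)`. -/
noncomputable def Pip {n p : ℕ} (A : Matrix (Fin n) (Fin n) ℝ)
    (B : Fin p → Matrix (Fin n) (Fin n) ℝ) (K : Matrix (Fin p) (Fin p) ℝ)
    (f : Fin n → ℝ) (ℓ : Fin p → ℝ) (c : ℝ) (w : Fin n → ℝ) : ℝ :=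
  ⨆ σ : Fin p → ℝ, Xi A B K f ℓ c w σ

/-- The canonical dual function
`Π_d(σ) = −(1/2) fᵀ G(σ)⁻¹ f − (1/2) σᵀ K σ − ℓᵀ σ − c`. -/
noncomputable def Pid {n p : ℕ} (A : Matrix (Fin n) (Fin n) ℝ)
    (B : Fin p → Matrix (Fin n) (Fin n) ℝ) (K : Matrix (Fin p) (Fin p) ℝ)
    (f : Fin n → ℝ) (ℓ : Fin p → ℝ) (c : ℝ) (σ : Fin p → ℝ) : ℝ :=
  -(1/2) * (f ⬝ᵥ (G A B σ)⁻¹.mulVec f) - (1/2) * (σ ⬝ᵥ K.mulVec σ) - ℓ ⬝ᵥ σ - c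

/-- Completing the square: if `M x₀ = b` then `x₀` is the vertex of `x ↦ (1/2) xᵀ M x − bᵀ x`. -/
theorem Matrix.IsSymm.half_quadratic_sub_linear {m : ℕ} {M : Matrix (Fin m) (Fin m) ℝ}
    (hM : M.IsSymm) {x₀ b : Fin m → ℝ} (h : M.mulVec x₀ = b) (x : Fin m → ℝ) :
    (1/2) * (x ⬝ᵥ M.mulVec x) - b ⬝ᵥ x
      = -(1/2) * (b ⬝ᵥ x₀) + (1/2) * ((x - x₀) ⬝ᵥ M.mulVec (x - x₀)) := by
  have h₁ : x₀ ⬝ᵥ M.mulVec x = b ⬝ᵥ x := by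
    rw [dotProduct_mulVec, ← mulVec_transpose, hM.eq, h]
  rw [mulVec_sub, h, sub_dotProduct, dotProduct_sub, dotProduct_sub, h₁,
    dotProduct_comm x b, dotProduct_comm x₀ b]
  ring

theorem Matrix.PosDef.dotProduct_mulVec_self_nonneg {m : ℕ} {M : Matrix (Fin m) (Fin m) ℝ}
    (hM : M.PosDef) (x : Fin m → ℝ) : 0 ≤ x ⬝ᵥ M.mulVec x := by
  simpa using hM.posSemidef.dotProduct_mulVec_nonneg x

theorem Matrix.PosDef.isSymm_real {m : ℕ} {M : Matrix (Fin m) (Fin m) ℝ}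
    (hM : M.PosDef) : M.IsSymm := by
  simpa [Matrix.IsHermitian, Matrix.IsSymm, conjTranspose_eq_transpose_of_trivial]
    using hM.isHermitian

theorem Matrix.PosDef.mulVec_inv_mulVec {m : ℕ} {M : Matrix (Fin m) (Fin m) ℝ}
    (hM : M.PosDef) (b : Fin m → ℝ) : M.mulVec (M⁻¹.mulVec b) = b := by
  rw [mulVec_mulVec, mul_nonsing_inv _ ((isUnit_iff_isUnit_det M).mp hM.isUnit), one_mulVec]

section Duality

variable {n p : ℕ} (A : Matrix (Fin n) (Fin n) ℝ) (B : Fin p → Matrix (Fin n) (Fin n) ℝ)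
  {K : Matrix (Fin p) (Fin p) ℝ} (f : Fin n → ℝ) (ℓ : Fin p → ℝ) (c : ℝ)

theorem half_dotProduct_G_mulVec (w : Fin n → ℝ) (σ : Fin p → ℝ) :
    (1/2) * (w ⬝ᵥ (G A B σ).mulVec w) = (1/2) * (w ⬝ᵥ A.mulVec w) + hq B w ⬝ᵥ σ := by
  have h : w ⬝ᵥ (∑ i, σ i • B i).mulVec w = ∑ i, σ i * (w ⬝ᵥ (B i).mulVec w) := by
    rw [sum_mulVec, dotProduct_sum]
    simp only [smul_mulVec, dotProduct_smul, smul_eq_mul]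
  rw [G, add_mulVec, dotProduct_add, h, mul_add, Finset.mul_sum]
  congr 1
  exact Finset.sum_congr rfl fun i _ => by simp only [hq]; ring

theorem Xi_le_of_mulVec_eq (hK : K.PosDef) {w : Fin n → ℝ} {σ₀ : Fin p → ℝ}
    (h : K.mulVec σ₀ = hq B w - ℓ) (σ : Fin p → ℝ) :
    Xi A B K f ℓ c w σ ≤ Xi A B K f ℓ c w σ₀ := by
  have h₁ := hK.isSymm_real.half_quadratic_sub_linear h σ
  have h₂ := hK.isSymm_real.half_quadratic_sub_linear h σ₀
  have h₃ := hK.dotProduct_mulVec_self_nonneg (σ - σ₀)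
  simp only [sub_self, zero_dotProduct, sub_dotProduct (hq B w)] at h₁ h₂
  simp only [Xi, half_dotProduct_G_mulVec]
  linarith

theorem bddAbove_range_Xi (hK : K.PosDef) (w : Fin n → ℝ) :
    BddAbove (Set.range fun σ => Xi A B K f ℓ c w σ) :=
  ⟨_, Set.forall_mem_range.mpr
    (Xi_le_of_mulVec_eq A B f ℓ c hK (hK.mulVec_inv_mulVec (hq B w - ℓ)))⟩

theorem Pip_eq_Xi_of_mulVec_eq (hK : K.PosDef) {w : Fin n → ℝ} {σ₀ : Fin p → ℝ}
    (h : K.mulVec σ₀ = hq B w - ℓ) : Pip A B K f ℓ c w = Xi A B K f ℓ c w σ₀ :=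
  le_antisymm (ciSup_le (Xi_le_of_mulVec_eq A B f ℓ c hK h))
    (le_ciSup (bddAbove_range_Xi A B f ℓ c hK w) σ₀)

theorem Xi_eq_Pid_add {σ : Fin p → ℝ} (hσ : (G A B σ).PosDef) (w : Fin n → ℝ) :
    Xi A B K f ℓ c w σ = Pid A B K f ℓ c σ + (1/2) *
      ((w - (G A B σ)⁻¹.mulVec f) ⬝ᵥ (G A B σ).mulVec (w - (G A B σ)⁻¹.mulVec f)) := by
  have h := hσ.isSymm_real.half_quadratic_sub_linear (hσ.mulVec_inv_mulVec f) w
  simp only [Xi, Pid]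
  linarith

theorem Pid_le_Xi {σ : Fin p → ℝ} (hσ : (G A B σ).PosDef) (w : Fin n → ℝ) :
    Pid A B K f ℓ c σ ≤ Xi A B K f ℓ c w σ := by
  rw [Xi_eq_Pid_add A B f ℓ c hσ w]
  linarith [hσ.dotProduct_mulVec_self_nonneg (w - (G A B σ)⁻¹.mulVec f)]

theorem Xi_eq_Pid_of_mulVec_eq {σ : Fin p → ℝ} (hσ : (G A B σ).PosDef) {w : Fin n → ℝ}
    (h : (G A B σ).mulVec w = f) : Xi A B K f ℓ c w σ = Pid A B K f ℓ c σ := by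
  rw [Xi_eq_Pid_add A B f ℓ c hσ w, mulVec_sub, h, hσ.mulVec_inv_mulVec f]
  simp

end Duality

/-- Canonical min-max duality: if `(w̄,σ̄)` is a stationary point of `Ξ` with
`G(σ̄)` positive definite, then `w̄` is a global minimizer of `Π_p` on `ℝⁿ`, `σ̄` is
a global maximizer of `Π_d` on `S⁺`, they share the same value, and in particular
the two global optimality statements are equivalent. -/
theorem stmt_13 (n p : ℕ) (hn : 0 < n) (hp : 0 < p)
    (A : Matrix (Fin n) (Fin n) ℝ) (hA : A.IsSymm)
    (B : Fin p → Matrix (Fin n) (Fin n) ℝ) (hB : ∀ i, (B i).IsSymm)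
    (K : Matrix (Fin p) (Fin p) ℝ) (hK : K.PosDef)
    (f : Fin n → ℝ) (ℓ : Fin p → ℝ) (c : ℝ)
    (wbar : Fin n → ℝ) (σbar : Fin p → ℝ)
    (hstat1 : (G A B σbar).mulVec wbar = f)
    (hstat2 : hq B wbar - K.mulVec σbar - ℓ = 0)
    (hGpd : (G A B σbar).PosDef) :
    (∀ w : Fin n → ℝ, Pip A B K f ℓ c wbar ≤ Pip A B K f ℓ c w) ∧
      (∀ σ : Fin p → ℝ, (G A B σ).PosDef →
        Pid A B K f ℓ c σ ≤ Pid A B K f ℓ c σbar) ∧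
      Pip A B K f ℓ c wbar = Pid A B K f ℓ c σbar ∧
      ((∀ w : Fin n → ℝ, Pip A B K f ℓ c wbar ≤ Pip A B K f ℓ c w) ↔
        (∀ σ : Fin p → ℝ, (G A B σ).PosDef →
          Pid A B K f ℓ c σ ≤ Pid A B K f ℓ c σbar)) := by
  have hσ : K.mulVec σbar = hq B wbar - ℓ := by
    rw [sub_right_comm] at hstat2
    exact (sub_eq_zero.mp hstat2).symm
  have hPip := Pip_eq_Xi_of_mulVec_eq A B f ℓ c hK hσ
  have hPid := Xi_eq_Pid_of_mulVec_eq (K := K) A B f ℓ c hGpd hstat1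
  have hmin : ∀ w, Pip A B K f ℓ c wbar ≤ Pip A B K f ℓ c w := fun w =>
    calc Pip A B K f ℓ c wbar = Pid A B K f ℓ c σbar := hPip.trans hPid
      _ ≤ Xi A B K f ℓ c w σbar := Pid_le_Xi A B f ℓ c hGpd w
      _ ≤ Pip A B K f ℓ c w := le_ciSup (bddAbove_range_Xi A B f ℓ c hK w) σbar
  have hmax : ∀ σ, (G A B σ).PosDef → Pid A B K f ℓ c σ ≤ Pid A B K f ℓ c σbar := fun σ h =>
    calc Pid A B K f ℓ c σ ≤ Xi A B K f ℓ c wbar σ := Pid_le_Xi A B f ℓ c h wbar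
      _ ≤ Xi A B K f ℓ c wbar σbar := Xi_le_of_mulVec_eq A B f ℓ c hK hσ σ
      _ = Pid A B K f ℓ c σbar := hPid
  exact ⟨hmin, hmax, hPip.trans hPid, fun _ => hmax, fun _ => hmin⟩
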